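/- Let T be a rooted chain complete tree, endowed with the coarse wedge topology. If T is a Valdivia compact space, then the height of T is strictly less than ω₂ + 1. -/

import Mathlib

open Cardinal Ordinal Filter Set Topology

universe u v

section TreeDefs

variable {T : Type u} [PartialOrder T]

/-- `T` is a tree: the set of strict predecessors of every point is well-ordered by `<`. -/
def IsTreeOrder (T : Type u) [PartialOrder T] : Prop :=
  ∀ x : T, IsWellOrder {y : T // y < x} (· < ·)

/-- Every chain has a supremum. -/
def ChainComplete (T : Type u) [PartialOrder T] : Prop :=
  ∀ c : Set T, IsChain (· ≤ ·) c → ∃ s, IsLUB c s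

open Classical in
/-- The height `ht(x,T)` of `x`: the order type of the set of its strict predecessors. -/
noncomputable def htx (x : T) : Ordinal.{u} :=
  if h : IsWellOrder {y : T // y < x} (· < ·) then @Ordinal.type {y : T // y < x} (· < ·) h
  else 0

/-- The cofinality `cf(x)` of `ht(x,T)`. -/
noncomputable def cfx (x : T) : Cardinal.{u} := (htx x).cof

/-- `x` lies on a successor level. -/
def SuccLevel (x : T) : Prop := ∃ β : Ordinal, htx x = β + 1

/-- The set of immediate successors of `x`. -/
def ims (x : T) : Set T := {y | x < y ∧ htx y = htx x + 1}

/-- The wedge `V_t = {s : t ≤ s}`. -/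
def Vset (t : T) : Set T := {s | t ≤ s}

/-- Condition (*): every `t` with `cf(t) ≥ ω₁` has finitely many immediate successors. -/
def StarCond (T : Type u) [PartialOrder T] : Prop :=
  ∀ t : T, Cardinal.aleph 1 ≤ cfx t → (ims t).Finite

/-- The coarse wedge topology: generated by the sets `V_t` and their complements,
for `t` minimal or on a successor level. -/
def coarseWedge (T : Type u) [PartialOrder T] : TopologicalSpace T :=
  TopologicalSpace.generateFrom
    {U : Set T | ∃ t : T, (IsMin t ∨ SuccLevel t) ∧ (U = Vset t ∨ U = (Vset t)ᶜ)}

open Classical in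
/-- `s ∧ t = max (ŝ ∩ t̂)`, the largest common predecessor (when it exists). -/
noncomputable def wedge (s t : T) : T :=
  if h : ∃ m, IsGreatest {r : T | r ≤ s ∧ r ≤ t} m then h.choose else s

open Classical in
/-- `ψ(t) = ims(t)` if `cf(t) ≥ ω₁`, and `ψ(t) = {0}` (the root) otherwise. -/
noncomputable def psiSet (root : T) (t : T) : Set T :=
  if Cardinal.aleph 1 ≤ cfx t then ims t else {root}

/-- `φ` is a choice function assigning to every `t` with `cf(t) = ω` a sequence of
successor-level elements strictly below `t` converging to `t`, and the constant
sequence at the root otherwise. -/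
def PhiSpec [TopologicalSpace T] (root : T) (φ : T → ℕ → T) : Prop :=
  ∀ t : T,
    (cfx t ≠ Cardinal.aleph0 → ∀ n, φ t n = root) ∧
    (cfx t = Cardinal.aleph0 →
      (∀ n, φ t n < t ∧ SuccLevel (φ t n)) ∧ Tendsto (φ t) atTop (nhds t))

/-- Membership in the family `𝒜(T)`: countable subsets containing the root, closed
under `∧`, `φ` and `ψ`. -/
structure Admissible (root : T) (φ : T → ℕ → T) (A : Set T) : Prop where
  countable : A.Countable
  root_mem : root ∈ A
  wedge_mem : ∀ s ∈ A, ∀ t ∈ A, wedge s t ∈ A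
  phi_mem : ∀ t ∈ A, ∀ n, φ t n ∈ A
  psi_mem : ∀ t ∈ A, psiSet root t ⊆ A

/-- The height of the tree `T`: the least `α` such that the level `α` of `T` is empty. -/
noncomputable def treeHeight (T : Type u) [PartialOrder T] : Ordinal.{u} :=
  sInf {α : Ordinal | ∀ x : T, htx x ≠ α}

end TreeDefs

/-- A retractional skeleton on a compact space `K`: a family of continuous retractions
with metrizable compact ranges, indexed by an up-directed partially ordered set,
commuting under the order, continuous under countable increasing suprema, and
converging pointwise to the identity. -/
structure RetractionalSkeleton (K : Type v) [TopologicalSpace K] where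
  Γ : Type v
  [po : PartialOrder Γ]
  [ne : Nonempty Γ]
  directed : ∀ s t : Γ, ∃ u, s ≤ u ∧ t ≤ u
  r : Γ → K → K
  cont : ∀ s, Continuous (r s)
  retraction : ∀ s x, r s (r s x) = r s x
  compact_range : ∀ s, IsCompact (Set.range (r s))
  metrizable_range : ∀ s, TopologicalSpace.MetrizableSpace (Set.range (r s))
  comm : ∀ s t : Γ, s ≤ t → ∀ x, r s (r t x) = r s x ∧ r t (r s x) = r s x
  seq_sup : ∀ s : ℕ → Γ, Monotone s → ∃ t : Γ, IsLUB (Set.range s) t ∧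
      ∀ x, Tendsto (fun n => r (s n) x) atTop (nhds (r t x))
  net_conv : ∀ x : K, Tendsto (fun s : Γ => r s x) atTop (nhds x)

/-- The subset induced by a retractional skeleton: `D = ⋃ₛ rₛ[K]`. -/
def RetractionalSkeleton.inducedSet {K : Type v} [TopologicalSpace K]
    (R : RetractionalSkeleton K) : Set K :=
  ⋃ s : R.Γ, Set.range (R.r s)

/-- `A` is a `Σ`-subset of `K`: for some homeomorphic injection `h` of `K` into a cube
`[0,1]^Γ`, `h(A) = h(K) ∩ Σ(Γ)`. -/
def IsSigmaSubset {K : Type v} [TopologicalSpace K] (A : Set K) : Prop :=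
  ∃ (Γ : Type v) (h : K → Γ → Set.Icc (0 : ℝ) 1),
    Topology.IsEmbedding h ∧
      h '' A = Set.range h ∩ {x | {γ | (x γ : ℝ) ≠ 0}.Countable}

/-- `K` is a Valdivia compact space: it has a dense `Σ`-subset. -/
def IsValdivia (K : Type v) [TopologicalSpace K] : Prop :=
  ∃ A : Set K, Dense A ∧ IsSigmaSubset A

/-- The bounded topology on a product `∏_{α<ω₁} X_α`: basic open sets are the sets
`V(g,β) = {f : f↾β = g↾β}` for `β < ω₁`. -/
def boundedTopology (X : Set.Iio (Cardinal.aleph 1).ord → Type v) :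
    TopologicalSpace (∀ α, X α) :=
  TopologicalSpace.generateFrom
    {U | ∃ (g : ∀ α, X α) (β : Ordinal), β < (Cardinal.aleph 1).ord ∧
      U = {f | ∀ α : Set.Iio (Cardinal.aleph 1).ord, (α : Ordinal) < β → f α = g α}}

section TreeHeight

variable {T : Type u} [PartialOrder T]

/-- Below `x`, the height in the tree is the position in the well-order of predecessors of `x`. -/
lemma htx_eq_typein (htree : IsTreeOrder T) {x y : T} (h : y < x) :
    htx y = @Ordinal.typein {y : T // y < x} (· < ·) (htree x) ⟨y, h⟩ := by
  have := htree x
  have := htree y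
  rw [htx, dif_pos (htree y), Ordinal.typein]
  refine Ordinal.type_eq.2 ⟨⟨⟨fun z => ⟨⟨z.1, z.2.trans h⟩, z.2⟩,
    fun z => ⟨z.1.1, z.2⟩, fun z => rfl, fun z => rfl⟩, ?_⟩⟩
  intro a b
  rfl

lemma htx_eq_type (htree : IsTreeOrder T) (x : T) :
    htx x = @Ordinal.type {y : T // y < x} (· < ·) (htree x) := by
  rw [htx, dif_pos (htree x)]

lemma htx_lt_htx (htree : IsTreeOrder T) {x y : T} (h : y < x) : htx y < htx x := by
  have := htree x
  rw [htx_eq_typein htree h, htx_eq_type htree x]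
  exact Ordinal.typein_lt_type _ _

lemma exists_lt_htx_eq (htree : IsTreeOrder T) {x : T} {β : Ordinal.{u}} (h : β < htx x) :
    ∃ y < x, htx y = β := by
  have := htree x
  rw [htx_eq_type htree x] at h
  obtain ⟨⟨y, hy⟩, hyβ⟩ := Ordinal.typein_surj (α := {y : T // y < x}) (· < ·) h
  exact ⟨y, hy, (htx_eq_typein htree hy).trans hyβ⟩

lemma lt_of_htx_lt_htx (htree : IsTreeOrder T) {x y z : T} (hy : y < x) (hz : z < x)
    (h : htx y < htx z) : y < z := by
  have := htree x
  rw [htx_eq_typein htree hy, htx_eq_typein htree hz, Ordinal.typein_lt_typein] at h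
  exact h

lemma le_or_le_of_le (htree : IsTreeOrder T) {x y z : T} (hy : y ≤ x) (hz : z ≤ x) :
    y ≤ z ∨ z ≤ y := by
  rcases hy.eq_or_lt with rfl | hy
  · exact Or.inr hz
  rcases hz.eq_or_lt with rfl | hz
  · exact Or.inl hy.le
  have := htree x
  rcases trichotomous_of (α := {y : T // y < x}) (· < ·) ⟨y, hy⟩ ⟨z, hz⟩ with h | h | h
  · exact Or.inl (le_of_lt (show y < z from h))
  · exact Or.inl (Subtype.ext_iff.1 h).le
  · exact Or.inr (le_of_lt (show z < y from h))

/-- Below a point of height `ω₂`, any `ℵ₁` many points have an upper bound on a successor level. -/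
lemma exists_succLevel_bound (htree : IsTreeOrder T) {x : T} (hx : htx x = (Cardinal.aleph 2).ord)
    (S : Set T) (hS : ∀ y ∈ S, y < x) (hcard : #S ≤ Cardinal.aleph 1) :
    ∃ z < x, SuccLevel z ∧ ∀ y ∈ S, y < z := by
  have hlim : Order.IsSuccLimit (Cardinal.aleph.{u} 2).ord :=
    Cardinal.isSuccLimit_ord (Cardinal.aleph0_le_aleph 2)
  have hreg : (Cardinal.aleph.{u} 2).IsRegular := by
    have := Cardinal.isRegular_aleph_add_one.{u} 1
    rwa [one_add_one_eq_two] at this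
  have hsup : (⨆ y : S, htx y.1) < (Cardinal.aleph.{u} 2).ord := by
    refine Ordinal.iSup_lt_of_lt_cof ?_ fun y => hx ▸ htx_lt_htx htree (hS y y.2)
    rw [hreg.cof_ord]
    exact hcard.trans_lt (Cardinal.aleph_lt_aleph.2 (by norm_num))
  obtain ⟨z, hz, hzβ⟩ := exists_lt_htx_eq (x := x) htree (hx ▸ hlim.add_one_lt hsup)
  refine ⟨z, hz, ⟨_, hzβ⟩, fun y hy => lt_of_htx_lt_htx htree (hS y hy) hz ?_⟩
  rw [hzβ, Order.lt_add_one_iff]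
  exact Ordinal.le_iSup (fun y : S => htx y.1) ⟨y, hy⟩

lemma exists_succLevel_bound_of_countable (htree : IsTreeOrder T) {x : T}
    (hx : htx x = (Cardinal.aleph 2).ord) {S : Set T} (hS : ∀ y ∈ S, y < x) (hc : S.Countable) :
    ∃ z < x, SuccLevel z ∧ ∀ y ∈ S, y < z :=
  exists_succLevel_bound htree hx S hS
    ((Cardinal.le_aleph0_iff_set_countable.2 hc).trans (Cardinal.aleph0_le_aleph 1))

/-- A coarse wedge neighbourhood of a point `x` of height `ω₂` contains `V_t \ V_x` for
some `t < x`. -/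
lemma exists_wedge_diff_subset (htree : IsTreeOrder T) (hcc : ChainComplete T) {x : T}
    (hx : htx x = (Cardinal.aleph 2).ord) {U : Set T} (hU : IsOpen[coarseWedge T] U) (hxU : x ∈ U) :
    ∃ t < x, ∀ z, t ≤ z → ¬ x ≤ z → z ∈ U := by
  have hlim : Order.IsSuccLimit (Cardinal.aleph.{u} 2).ord :=
    Cardinal.isSuccLimit_ord (Cardinal.aleph0_le_aleph 2)
  obtain ⟨t₀, ht₀, -⟩ := exists_succLevel_bound_of_countable htree hx (S := ∅) (by simp) (by simp)
  change TopologicalSpace.GenerateOpen _ U at hU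
  induction hU with
  | basic U hU =>
    obtain ⟨s, hs, rfl | rfl⟩ := hU
    · have hsx : s ≤ x := hxU
      rcases hsx.eq_or_lt with rfl | hsx
      · rcases hs with hs | ⟨β, hβ⟩
        · exact absurd ht₀ hs.not_lt
        · rw [hx] at hβ
          have hlt : β < (Cardinal.aleph.{u} 2).ord := by
            rw [hβ]
            exact Order.lt_add_one_iff.2 le_rfl
          exact absurd (hlim.add_one_lt hlt) (by rw [← hβ]; exact lt_irrefl _)
      · exact ⟨s, hsx, fun z hz _ => hz⟩
    · have hsx : ¬ s ≤ x := hxU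
      by_cases h : ∃ t < x, ¬ t ≤ s
      · obtain ⟨t, htx, hts⟩ := h
        refine ⟨t, htx, fun z htz _ hsz => ?_⟩
        rcases le_or_le_of_le htree htz hsz with h | h
        · exact hts h
        · exact hsx (h.trans htx.le)
      · push Not at h
        obtain ⟨c, hc⟩ := hcc (Set.Iio x) fun a ha b hb _ => le_or_le_of_le htree ha.le hb.le
        have hcx : c = x := by
          refine (hc.2 fun y hy => le_of_lt hy).eq_of_not_lt fun hlt => ?_
          obtain ⟨z, hz, -, hz'⟩ := exists_succLevel_bound_of_countable htree hx (S := {c})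
            (by simpa using hlt) (by simp)
          exact (hz' c rfl).not_ge (hc.1 hz)
        have hxs : x ≤ s := hcx ▸ hc.2 h
        exact ⟨t₀, ht₀, fun z _ hxz hsz => hxz (hxs.trans hsz)⟩
  | univ => exact ⟨t₀, ht₀, fun _ _ _ => trivial⟩
  | inter U V _ _ ihU ihV =>
    obtain ⟨t, ht, htU⟩ := ihU hxU.1
    obtain ⟨s, hs, hsV⟩ := ihV hxU.2
    obtain ⟨z, hz, -, hzb⟩ := exists_succLevel_bound_of_countable htree hx (S := {t, s})
      (by simp [ht, hs]) (by simp)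
    exact ⟨z, hz, fun w hw hxw => ⟨htU w ((hzb t (by simp)).le.trans hw) hxw,
      hsV w ((hzb s (by simp)).le.trans hw) hxw⟩⟩
  | sUnion 𝒮 _ ih =>
    obtain ⟨U, hU, hxU⟩ := hxU
    obtain ⟨t, ht, htU⟩ := ih U hU hxU
    exact ⟨t, ht, fun z hz hxz => ⟨U, hU, htU z hz hxz⟩⟩

/-- A continuous map to a metric space is constant on `V_t \ V_x` for some `t < x`, when `x` has
height `ω₂`. -/
lemma exists_forall_eq_of_continuous (htree : IsTreeOrder T) (hcc : ChainComplete T) {x : T}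
    (hx : htx x = (Cardinal.aleph 2).ord) {M : Type*} [MetricSpace M] {f : T → M}
    (hf : @Continuous T M (coarseWedge T) _ f) :
    ∃ t < x, ∀ z, t ≤ z → ¬ x ≤ z → f z = f x := by
  have key (n : ℕ) : ∃ t < x, ∀ z, t ≤ z → ¬ x ≤ z → f z ∈ Metric.ball (f x) (1 / (n + 1 : ℝ)) :=
    exists_wedge_diff_subset htree hcc hx
      (@Continuous.isOpen_preimage _ _ (coarseWedge T) _ f hf _ Metric.isOpen_ball)
      (Metric.mem_ball_self (by positivity))
  choose t ht htb using key
  obtain ⟨z, hz, -, hzb⟩ := exists_succLevel_bound_of_countable htree hx (S := Set.range t)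
    (by rintro _ ⟨n, rfl⟩; exact ht n) (Set.countable_range t)
  refine ⟨z, hz, fun w hw hxw => dist_le_zero.1 (le_of_forall_pos_lt_add fun ε hε => ?_)⟩
  obtain ⟨n, hn⟩ := exists_nat_one_div_lt hε
  have := htb n w ((hzb _ ⟨n, rfl⟩).le.trans hw) hxw
  rw [zero_add]
  exact (Metric.mem_ball.1 this).trans hn

end TreeHeight

/-- A rooted chain complete Valdivia tree has no point of height `ω₂`. -/
lemma htx_ne_ord_aleph_two {T : Type u} [PartialOrder T] [τ : TopologicalSpace T]
    (hτ : τ = coarseWedge T) (htree : IsTreeOrder T) (hcc : ChainComplete T)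
    (hV : IsValdivia T) (x : T) : htx x ≠ (Cardinal.aleph 2).ord := by
  intro hx
  obtain ⟨A, hA, Γ, h, hemb, himg⟩ := hV
  have hopen {s : T} (hs : SuccLevel s) : IsOpen (Vset s) ∧ IsOpen (Vset s)ᶜ := by
    subst hτ
    exact ⟨TopologicalSpace.isOpen_generateFrom_of_mem ⟨s, Or.inr hs, Or.inl rfl⟩,
      TopologicalSpace.isOpen_generateFrom_of_mem ⟨s, Or.inr hs, Or.inr rfl⟩⟩
  have hsupp (a : T) (ha : a ∈ A) : {γ | (h a γ : ℝ) ≠ 0}.Countable :=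
    ((Set.ext_iff.1 himg (h a)).1 ⟨a, ha, rfl⟩).2
  have hconst (γ : Γ) : ∃ t < x, ∀ z, t ≤ z → ¬ x ≤ z → h z γ = h x γ :=
    exists_forall_eq_of_continuous htree hcc hx
      (hτ ▸ (continuous_apply γ).comp hemb.continuous)
  choose t ht hth using hconst
  have hpick (y : T) (hy : y < x) : ∃ a ∈ A, ∃ z < x, y ≤ a ∧ ¬ z ≤ a ∧ y < z := by
    obtain ⟨s, hs, hss, hys⟩ := exists_succLevel_bound_of_countable htree hx (S := {y})
      (by simpa using hy) (by simp)
    obtain ⟨z, hz, hzs, hsz⟩ := exists_succLevel_bound_of_countable htree hx (S := {s})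
      (by simpa using hs) (by simp)
    have ho : IsOpen (Vset s ∩ (Vset z)ᶜ) :=
      (hopen hss).1.inter (hopen hzs).2
    obtain ⟨a, ⟨hsa, hza⟩, haA⟩ := hA.inter_open_nonempty _ ho ⟨s, le_rfl, (hsz s rfl).not_ge⟩
    exact ⟨a, haA, z, hz, (hys y rfl).le.trans hsa, hza, (hys y rfl).trans (hsz s rfl)⟩
  have hxsupp : {γ | (h x γ : ℝ) ≠ 0}.Countable := by
    rw [← Cardinal.le_aleph0_iff_set_countable]
    by_contra hlt
    rw [not_le, ← Order.succ_le_iff, Cardinal.succ_aleph0] at hlt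
    obtain ⟨S, hS, hScard⟩ := Cardinal.le_mk_iff_exists_subset.1 hlt
    obtain ⟨y, hy, -, hyb⟩ := exists_succLevel_bound htree hx (t '' S)
      (by rintro _ ⟨γ, -, rfl⟩; exact ht γ) (Cardinal.mk_image_le.trans hScard.le)
    obtain ⟨a, haA, z, hz, hya, hza, -⟩ := hpick y hy
    have hsub : S ⊆ {γ | (h a γ : ℝ) ≠ 0} := fun γ hγ => by
      have := hth γ a ((hyb _ ⟨γ, hγ, rfl⟩).le.trans hya) fun hxa => hza (hz.le.trans hxa)
      rw [Set.mem_ofPred_eq, this]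
      exact hS hγ
    have := Cardinal.le_aleph0_iff_set_countable.2 ((hsupp a haA).mono hsub)
    exact (hScard ▸ this).not_gt Cardinal.aleph0_lt_aleph_one
  have hstep (y : Set.Iio x) : ∃ a ∈ A, ∃ w : Set.Iio x, y.1 ≤ a ∧ ¬ w.1 ≤ a ∧ y < w ∧
      ∀ γ, (h x γ : ℝ) ≠ 0 ∨ (h a γ : ℝ) ≠ 0 → ∀ b, w.1 ≤ b → ¬ x ≤ b → h b γ = h x γ := by
    obtain ⟨a, haA, z, hz, hya, hza, hyz⟩ := hpick y y.2
    obtain ⟨w, hw, -, hwb⟩ := exists_succLevel_bound_of_countable htree hx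
      (S := insert z (t '' ({γ | (h x γ : ℝ) ≠ 0} ∪ {γ | (h a γ : ℝ) ≠ 0})))
      (by rintro _ (rfl | ⟨γ, -, rfl⟩); exacts [hz, ht γ])
      (((hxsupp.union (hsupp a haA)).image t).insert z)
    refine ⟨a, haA, ⟨w, hw⟩, hya, fun hwa => hza ((hwb z (by simp)).le.trans hwa),
      hyz.trans (hwb z (by simp)), fun γ hγ b hwb' hxb => hth γ b ?_ hxb⟩
    exact (hwb _ (Or.inr ⟨γ, hγ, rfl⟩)).le.trans hwb'
  choose a haA g hya hga hyg hconst using hstep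
  obtain ⟨y₀, hy₀, -⟩ := exists_succLevel_bound_of_countable htree hx (S := ∅) (by simp) (by simp)
  let y (n : ℕ) : Set.Iio x := g^[n] ⟨y₀, hy₀⟩
  have hysucc (n : ℕ) : y (n + 1) = g (y n) := Function.iterate_succ_apply' g n _
  have hymono : Monotone y := monotone_nat_of_le_succ fun n => (hysucc n).symm ▸ (hyg (y n)).le
  have hlim : Tendsto (fun n => a (y n)) atTop (nhds x) := by
    rw [hemb.tendsto_nhds_iff, tendsto_pi_nhds]
    intro γ
    refine tendsto_const_nhds.congr' ?_
    by_cases hγ : ∃ n, (h x γ : ℝ) ≠ 0 ∨ (h (a (y n)) γ : ℝ) ≠ 0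
    · obtain ⟨n, hn⟩ := hγ
      filter_upwards [eventually_ge_atTop (n + 1)] with m hm
      refine (hconst (y n) γ hn _ ?_ fun hxa => hga (y m) ((g (y m)).2.le.trans hxa)).symm
      rw [← hysucc]
      exact (show (y (n + 1)).1 ≤ (y m).1 from hymono hm).trans (hya (y m))
    · push Not at hγ
      exact Eventually.of_forall fun n => Subtype.ext ((hγ n).1.trans (hγ n).2.symm)
  obtain ⟨w, hw, hws, hwb⟩ := exists_succLevel_bound_of_countable htree hx
    (S := Set.range fun n => (y n).1) (by rintro _ ⟨n, rfl⟩; exact (y n).2)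
    (Set.countable_range _)
  have hwo : IsOpen (Vset w) := (hopen hws).1
  obtain ⟨n, hn⟩ := (hlim.eventually (hwo.mem_nhds hw.le)).exists
  refine hga (y n) (le_trans ?_ hn)
  rw [← hysucc]
  exact (hwb _ ⟨n + 1, rfl⟩).le

theorem stmt14 {T : Type u} [PartialOrder T] [τ : TopologicalSpace T]
    (hτ : τ = coarseWedge T) (htree : IsTreeOrder T) (hcc : ChainComplete T)
    (root : T) (hroot : ∀ x : T, root ≤ x)
    (hV : IsValdivia T) :
    treeHeight T < (Cardinal.aleph 2).ord + 1 := by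
  rw [Order.lt_add_one_iff]
  exact csInf_le' fun x => htx_ne_ord_aleph_two hτ htree hcc hV x
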